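/- With the dG setup below, the kernel of each of the discrete gradient operators G⁺, G⁻ : V_q → V_q is one-dimensional and consists exactly of the globally constant functions: for Φ ∈ V_q, G⁺[Φ] = 0 (respectively G⁻[Φ] = 0) if and only if there is a constant c ∈ ℝ with Φ(x) = c for all x in every open cell (x_n, x_{n+1}). -/

import Mathlib

open scoped BigOperators
open MeasureTheory Set

namespace DG

noncomputable def pev (q : ℕ) (c : ℕ → ℕ → ℝ) (n : ℕ) (y : ℝ) : ℝ :=
  ∑ k ∈ Finset.range (q + 1), c n k * y ^ k

noncomputable def pev' (q : ℕ) (c : ℕ → ℕ → ℝ) (n : ℕ) (y : ℝ) : ℝ :=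
  ∑ k ∈ Finset.range (q + 1), (k : ℝ) * c n k * y ^ (k - 1)

noncomputable def inner2 (q N : ℕ) (x : ℕ → ℝ) (c d : ℕ → ℕ → ℝ) : ℝ :=
  ∑ n ∈ Finset.range N, ∫ y in (x n)..(x (n + 1)), pev q c n y * pev q d n y

noncomputable def nsq (q N : ℕ) (x : ℕ → ℝ) (c : ℕ → ℕ → ℝ) : ℝ :=
  inner2 q N x c c

noncomputable def intg (q N : ℕ) (x : ℕ → ℝ) (c : ℕ → ℕ → ℝ) : ℝ :=
  ∑ n ∈ Finset.range N, ∫ y in (x n)..(x (n + 1)), pev q c n y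

noncomputable def valR (q : ℕ) (x : ℕ → ℝ) (c : ℕ → ℕ → ℝ) (n : ℕ) : ℝ :=
  pev q c n (x n)

noncomputable def valL (q N : ℕ) (x : ℕ → ℝ) (c : ℕ → ℕ → ℝ) (n : ℕ) : ℝ :=
  if n = 0 then pev q c (N - 1) (x N) else pev q c (n - 1) (x n)

noncomputable def jmp (q N : ℕ) (x : ℕ → ℝ) (c : ℕ → ℕ → ℝ) (n : ℕ) : ℝ :=
  valL q N x c n - valR q x c n

noncomputable def Bm (q N : ℕ) (x : ℕ → ℝ) (w Ψ : ℕ → ℕ → ℝ) : ℝ :=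
  (∑ n ∈ Finset.range N, ∫ y in (x n)..(x (n + 1)), pev' q w n y * pev q Ψ n y)
    - ∑ n ∈ Finset.range N, jmp q N x w n * valL q N x Ψ n

noncomputable def Bp (q N : ℕ) (x : ℕ → ℝ) (w Ψ : ℕ → ℕ → ℝ) : ℝ :=
  (∑ n ∈ Finset.range N, ∫ y in (x n)..(x (n + 1)), pev' q w n y * pev q Ψ n y)
    - ∑ n ∈ Finset.range N, jmp q N x w n * valR q x Ψ n

def IsGminus (q N : ℕ) (x : ℕ → ℝ) (w g : ℕ → ℕ → ℝ) : Prop :=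
  ∀ Ψ : ℕ → ℕ → ℝ, inner2 q N x g Ψ = Bm q N x w Ψ

def IsGplus (q N : ℕ) (x : ℕ → ℝ) (w g : ℕ → ℕ → ℝ) : Prop :=
  ∀ Ψ : ℕ → ℕ → ℝ, inner2 q N x g Ψ = Bp q N x w Ψ

noncomputable def hseg (x : ℕ → ℝ) (n : ℕ) : ℝ := x (n + 1) - x n

noncomputable def hprev (N : ℕ) (x : ℕ → ℝ) (n : ℕ) : ℝ :=
  if n = 0 then hseg x (N - 1) else hseg x (n - 1)

noncomputable def dGsq (q N : ℕ) (x : ℕ → ℝ) (w : ℕ → ℕ → ℝ) : ℝ :=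
  ∑ n ∈ Finset.range N,
    ((∫ y in (x n)..(x (n + 1)), (pev' q w n y) ^ 2)
      + 2 * (jmp q N x w n) ^ 2 / (hprev N x n + hseg x n))

def Partition (N : ℕ) (x : ℕ → ℝ) : Prop :=
  2 ≤ N ∧ x 0 = 0 ∧ x N = 1 ∧ ∀ n < N, x n < x (n + 1)

def MeshRatio (N : ℕ) (x : ℕ → ℝ) (ρ : ℝ) : Prop :=
  ∀ n < N, hseg x n ≤ ρ * hseg x ((n + 1) % N) ∧ hseg x ((n + 1) % N) ≤ ρ * hseg x n

end DG

namespace DG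

theorem hasDerivAt_pev (q : ℕ) (c : ℕ → ℕ → ℝ) (n : ℕ) (y : ℝ) :
    HasDerivAt (pev q c n) (pev' q c n y) y := by
  unfold pev pev'
  have h : ∀ k ∈ Finset.range (q + 1),
      HasDerivAt (fun y : ℝ => c n k * y ^ k) ((k : ℝ) * c n k * y ^ (k - 1)) y := by
    intro k _
    exact ((hasDerivAt_pow k y).const_mul (c n k)).congr_deriv (by ring)
  exact HasDerivAt.fun_sum h

theorem continuous_pev' (q : ℕ) (c : ℕ → ℕ → ℝ) (n : ℕ) : Continuous (pev' q c n) := by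
  unfold pev'
  fun_prop

theorem pev'_zero_of_Ioo (q : ℕ) (c : ℕ → ℕ → ℝ) (n : ℕ) (a b : ℝ) (hab : a < b)
    (h : ∀ y ∈ Ioo a b, pev' q c n y = 0) (y : ℝ) : pev' q c n y = 0 := by
  let P : Polynomial ℝ := ∑ k ∈ Finset.range (q + 1),
    Polynomial.C ((k : ℝ) * c n k) * Polynomial.X ^ (k - 1)
  have hP : ∀ y, P.eval y = pev' q c n y := by
    intro y
    simp only [P, pev', Polynomial.eval_finsetSum, Polynomial.eval_mul, Polynomial.eval_C,
      Polynomial.eval_pow, Polynomial.eval_X]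
  have h0 : P = 0 := by
    apply Polynomial.eq_zero_of_infinite_isRoot
    refine (Ioo_infinite hab).mono ?_
    intro y hy
    show P.eval y = 0
    rw [hP, h y hy]
  rw [← hP, h0, Polynomial.eval_zero]

/-- Coefficients of `(y - a n) * Φ'`. -/
noncomputable def tst (q : ℕ) (a : ℕ → ℝ) (c : ℕ → ℕ → ℝ) : ℕ → ℕ → ℝ :=
  fun n k => (k : ℝ) * c n k - a n * (if k < q then ((k : ℝ) + 1) * c n (k + 1) else 0)

theorem pev_tst (q : ℕ) (a : ℕ → ℝ) (c : ℕ → ℕ → ℝ) (n : ℕ) (y : ℝ) :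
    pev q (tst q a c) n y = (y - a n) * pev' q c n y := by
  have h1 : y * pev' q c n y = ∑ k ∈ Finset.range (q + 1), (k : ℝ) * c n k * y ^ k := by
    unfold pev'
    rw [Finset.mul_sum]
    refine Finset.sum_congr rfl fun k _ => ?_
    cases k with
    | zero => simp
    | succ k => simp only [Nat.add_sub_cancel]; ring
  have h2 : pev' q c n y = ∑ k ∈ Finset.range (q + 1),
      (if k < q then ((k : ℝ) + 1) * c n (k + 1) else 0) * y ^ k := by
    unfold pev'
    rw [Finset.sum_range_succ', Finset.sum_range_succ]
    simp only [lt_irrefl, if_false, Nat.cast_zero, zero_mul, add_zero]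
    refine Finset.sum_congr rfl fun k hk => ?_
    rw [if_pos (Finset.mem_range.mp hk)]
    simp
  rw [sub_mul, h1]
  rw [h2]
  unfold pev tst
  rw [Finset.mul_sum, ← Finset.sum_sub_distrib]
  refine Finset.sum_congr rfl fun k _ => ?_
  ring

theorem pev_cst (q : ℕ) (C : ℕ → ℝ) (n : ℕ) (y : ℝ) :
    pev q (fun n k => if k = 0 then C n else 0) n y = C n := by
  unfold pev
  rw [Finset.sum_range_succ']
  simp

theorem inner2_zero (q N : ℕ) (x : ℕ → ℝ) (Ψ : ℕ → ℕ → ℝ) :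
    inner2 q N x (fun _ _ => 0) Ψ = 0 := by
  simp [inner2, pev]

/-- Weighted vanishing on all cells forces zero derivative. -/
theorem deriv_zero (q N : ℕ) (x : ℕ → ℝ) (hx : ∀ n < N, x n < x (n + 1)) (Φ : ℕ → ℕ → ℝ)
    (r : ℕ → ℝ → ℝ) (hc : ∀ n, Continuous (r n))
    (hr : ∀ n < N, ∀ y ∈ Ioo (x n) (x (n + 1)), 0 < r n y)
    (h : ∑ n ∈ Finset.range N, ∫ y in (x n)..(x (n + 1)), r n y * pev' q Φ n y ^ 2 = 0) :
    ∀ n < N, ∀ y, pev' q Φ n y = 0 := by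
  have hcont : ∀ n, Continuous fun y => r n y * pev' q Φ n y ^ 2 := fun n =>
    (hc n).mul ((continuous_pev' q Φ n).pow 2)
  have hge : ∀ n < N, ∀ y ∈ Icc (x n) (x (n + 1)), 0 ≤ r n y * pev' q Φ n y ^ 2 := by
    intro n hn y hy
    have hcl : y ∈ closure (Ioo (x n) (x (n + 1))) := by
      rwa [closure_Ioo (hx n hn).ne]
    have hs : IsClosed {y | 0 ≤ r n y * pev' q Φ n y ^ 2} :=
      isClosed_le continuous_const (hcont n)
    refine closure_minimal ?_ hs hcl
    intro z hz
    exact mul_nonneg (hr n hn z hz).le (sq_nonneg _)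
  have hnn : ∀ n ∈ Finset.range N, 0 ≤ ∫ y in (x n)..(x (n + 1)), r n y * pev' q Φ n y ^ 2 := by
    intro n hn
    have hn := Finset.mem_range.mp hn
    exact intervalIntegral.integral_nonneg (hx n hn).le (hge n hn)
  have hz := (Finset.sum_eq_zero_iff_of_nonneg hnn).mp h
  intro n hn
  apply pev'_zero_of_Ioo q Φ n _ _ (hx n hn)
  intro y hy
  by_contra hne
  have hpos : 0 < ∫ y in (x n)..(x (n + 1)), r n y * pev' q Φ n y ^ 2 := by
    refine intervalIntegral.integral_pos (hx n hn) (hcont n).continuousOn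
      (fun y hy => hge n hn y (Ioc_subset_Icc_self hy)) ⟨y, Ioo_subset_Icc_self hy, ?_⟩
    have := hr n hn y hy
    positivity
  rw [hz n (Finset.mem_range.mpr hn)] at hpos
  exact lt_irrefl _ hpos

theorem const_of (q N : ℕ) (x : ℕ → ℝ) (Φ : ℕ → ℕ → ℝ)
    (hd : ∀ n < N, ∀ y, pev' q Φ n y = 0)
    (hj : ∑ n ∈ Finset.range N, jmp q N x Φ n * jmp q N x Φ n = 0) :
    ∃ c : ℝ, ∀ n < N, ∀ y : ℝ, pev q Φ n y = c := by
  have hz := (Finset.sum_eq_zero_iff_of_nonneg (fun n _ => mul_self_nonneg _)).mp hj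
  have hconst : ∀ n < N, ∀ y z, pev q Φ n y = pev q Φ n z := by
    intro n hn
    apply is_const_of_deriv_eq_zero
    · exact fun y => (hasDerivAt_pev q Φ n y).differentiableAt
    · intro y
      rw [(hasDerivAt_pev q Φ n y).deriv, hd n hn]
  refine ⟨pev q Φ 0 0, fun n => ?_⟩
  induction n with
  | zero => intro hn y; exact hconst 0 hn _ _
  | succ n ih =>
    intro hn y
    have h := mul_self_eq_zero.mp (hz (n + 1) (Finset.mem_range.mpr hn))
    simp only [jmp, valL, valR, Nat.add_sub_cancel, Nat.add_eq_zero_iff, one_ne_zero, and_false,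
      if_false] at h
    rw [hconst (n + 1) hn y (x (n + 1)), ← ih (by omega) (x (n + 1))]
    linarith

theorem of_const (q N : ℕ) (hN : 2 ≤ N) (x : ℕ → ℝ) (Φ : ℕ → ℕ → ℝ)
    (h : ∃ c : ℝ, ∀ n < N, ∀ y : ℝ, pev q Φ n y = c) :
    (∀ n < N, ∀ y, pev' q Φ n y = 0) ∧ ∀ n < N, jmp q N x Φ n = 0 := by
  obtain ⟨c, h⟩ := h
  constructor
  · intro n hn y
    have h1 := hasDerivAt_pev q Φ n y
    have h2 : pev q Φ n = fun _ => c := funext (h n hn)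
    rw [h2] at h1
    exact h1.unique (hasDerivAt_const y c)
  · intro n hn
    unfold jmp valL valR
    split_ifs
    · rw [h _ (by omega), h _ hn, sub_self]
    · rw [h _ (by omega), h _ hn, sub_self]

theorem vol_zero (q N : ℕ) (x : ℕ → ℝ) (Φ Ψ : ℕ → ℕ → ℝ)
    (hd : ∀ n < N, ∀ y, pev' q Φ n y = 0) :
    ∑ n ∈ Finset.range N, ∫ y in (x n)..(x (n + 1)), pev' q Φ n y * pev q Ψ n y = 0 := by
  refine Finset.sum_eq_zero fun n hn => ?_
  simp [hd n (Finset.mem_range.mp hn)]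

end DG

/-- Kernel of the discrete gradients, Lemma "The kernel of G±":
for Φ ∈ V_q one has G⁺[Φ] = 0 (resp. G⁻[Φ] = 0) if and only if Φ is globally
constant, i.e. there is c ∈ ℝ with Φ(y) = c for all y in every open cell.
Elements of V_q are represented by their cellwise polynomial coefficients. -/
theorem stmt_6 (q N : ℕ) (hq : 1 ≤ q) (x : ℕ → ℝ) (hpart : DG.Partition N x)
    (Φ : ℕ → ℕ → ℝ) :
    (DG.IsGplus q N x Φ (fun _ _ => 0) ↔
      ∃ c : ℝ, ∀ n < N, ∀ y : ℝ, DG.pev q Φ n y = c) ∧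
    (DG.IsGminus q N x Φ (fun _ _ => 0) ↔
      ∃ c : ℝ, ∀ n < N, ∀ y : ℝ, DG.pev q Φ n y = c) := by
  obtain ⟨hN, -, -, hx⟩ := hpart
  refine ⟨⟨fun h => ?_, fun h => ?_⟩, ⟨fun h => ?_, fun h => ?_⟩⟩
  · have hd : ∀ n < N, ∀ y, DG.pev' q Φ n y = 0 := by
      refine DG.deriv_zero q N x hx Φ (fun n y => y - x n) (fun n => by fun_prop)
        (fun n _ y hy => sub_pos.mpr hy.1) ?_
      have h1 := h (DG.tst q x Φ)
      rw [DG.inner2_zero, DG.Bp] at h1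
      have h2 : ∑ n ∈ Finset.range N, DG.jmp q N x Φ n * DG.valR q x (DG.tst q x Φ) n = 0 := by
        refine Finset.sum_eq_zero fun n _ => ?_
        rw [DG.valR, DG.pev_tst]
        ring
      rw [h2, sub_zero] at h1
      rw [h1]
      refine Finset.sum_congr rfl fun n _ => ?_
      congr 1
      funext y
      rw [DG.pev_tst]
      ring
    apply DG.const_of q N x Φ hd
    have h1 := h (fun n k => if k = 0 then DG.jmp q N x Φ n else 0)
    rw [DG.inner2_zero, DG.Bp, DG.vol_zero q N x Φ _ hd] at h1
    simp only [DG.valR, DG.pev_cst] at h1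
    linarith
  · obtain ⟨hd, hj⟩ := DG.of_const q N hN x Φ h
    intro Ψ
    rw [DG.inner2_zero, DG.Bp, DG.vol_zero q N x Φ _ hd, Finset.sum_eq_zero, sub_zero]
    intro n hn
    rw [hj n (Finset.mem_range.mp hn), zero_mul]
  · have hd : ∀ n < N, ∀ y, DG.pev' q Φ n y = 0 := by
      refine DG.deriv_zero q N x hx Φ (fun n y => x (n + 1) - y) (fun n => by fun_prop)
        (fun n _ y hy => sub_pos.mpr hy.2) ?_
      have h1 := h (DG.tst q (fun n => x (n + 1)) Φ)
      rw [DG.inner2_zero, DG.Bm] at h1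
      have h2 : ∑ n ∈ Finset.range N,
          DG.jmp q N x Φ n * DG.valL q N x (DG.tst q (fun n => x (n + 1)) Φ) n = 0 := by
        refine Finset.sum_eq_zero fun n _ => ?_
        rw [DG.valL]
        split_ifs with h0
        · rw [DG.pev_tst, Nat.sub_add_cancel (by omega)]
          ring
        · rw [DG.pev_tst, Nat.sub_add_cancel (by omega)]
          ring
      rw [h2, sub_zero] at h1
      rw [← neg_eq_zero, ← Finset.sum_neg_distrib, h1]
      refine Finset.sum_congr rfl fun n _ => ?_
      rw [← intervalIntegral.integral_neg]
      congr 1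
      funext y
      rw [DG.pev_tst]
      ring
    apply DG.const_of q N x Φ hd
    have h1 := h (fun n k => if k = 0 then
      (fun m => if m = N - 1 then DG.jmp q N x Φ 0 else DG.jmp q N x Φ (m + 1)) n else 0)
    rw [DG.inner2_zero, DG.Bm, DG.vol_zero q N x Φ _ hd, zero_sub, eq_comm, neg_eq_zero] at h1
    rw [← h1]
    refine Finset.sum_congr rfl fun n hn => ?_
    have hn := Finset.mem_range.mp hn
    congr 1
    rw [DG.valL]
    split_ifs with h0
    · rw [DG.pev_cst, if_pos rfl, h0]
    · rw [DG.pev_cst, if_neg (by omega), Nat.sub_add_cancel (by omega)]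
  · obtain ⟨hd, hj⟩ := DG.of_const q N hN x Φ h
    intro Ψ
    rw [DG.inner2_zero, DG.Bm, DG.vol_zero q N x Φ _ hd, Finset.sum_eq_zero, sub_zero]
    intro n hn
    rw [hj n (Finset.mem_range.mp hn), zero_mul]
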